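/- Let m₀ ≥ 7 be an integer and let h₀ be a real number with h₀ > 2/sin(π/m₀). Set K₀ := D̄(0,1), K_{j+1} := D̄(h₀·e^{2πij/m₀}, 1) for j = 0, 1, …, m₀−1, and L := ⋃_{i=0}^{m₀} K_i (these discs are pairwise disjoint and are the connected components of L, and ℂ ∖ L is connected). Let ℓ₀ := (1/2)·sin(π/m₀)·(1 − (1/2)·sin(π/m₀))·((3/2)·sin(π/m₀))^{m₀−1}. Then ρ_L ≤ ( (1 + h₀)·(1 + 2h₀)^{m₀−1} / (ℓ₀·h₀^{m₀+1}) )^{1/(m₀+1)}. -/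

import Mathlib

open Filter Topology Metric

/-- The `n`-th partial sum of the Taylor series of `f` at `z₀`:
`S_n(f,z₀)(z) = Σ_{k=0}^{n} (f^{(k)}(z₀)/k!)·(z−z₀)^k`. -/
noncomputable def taylorSum (f : ℂ → ℂ) (z₀ : ℂ) (n : ℕ) (z : ℂ) : ℂ :=
  ∑ k ∈ Finset.range (n + 1), (iteratedDeriv k f z₀ / (Nat.factorial k)) * (z - z₀) ^ k

/-- Supremum norm of `g` on `X`. -/
noncomputable def supNorm (g : ℂ → ℂ) (X : Set ℂ) : ℝ :=
  sSup ((fun z => ‖g z‖) '' X)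

/-- Membership in `A(X)`: continuous on `X` and holomorphic on the interior of `X`. -/
def memA (X : Set ℂ) (f : ℂ → ℂ) : Prop :=
  ContinuousOn f X ∧ DifferentiableOn ℂ f (interior X)

/-- Best sup-norm approximation error of `G` on `L` by polynomials of degree at most `n`. -/
noncomputable def dApprox (L : Set ℂ) (G : ℂ → ℂ) (n : ℕ) : ℝ :=
  sInf {c : ℝ | ∃ p : Polynomial ℂ, p.degree ≤ (n : ℕ) ∧
    c = supNorm (fun z => G z - Polynomial.eval z p) L}

/-- The asymptotic quantity `limsup_n d_n(G)^{1/n}`; for a function `G` which is equal to a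
different polynomial on each connected component of `L` this is the asymptotic convergence
factor `ρ_L` of `L`. -/
noncomputable def rho (L : Set ℂ) (G : ℂ → ℂ) : ℝ :=
  Filter.limsup (fun n : ℕ => dApprox L G n ^ (1 / (n : ℝ))) Filter.atTop

/-- The family of closed unit discs: `K₀ = D̄(0,1)` and
`K_{j+1} = D̄(h₀ e^{2πij/m₀}, 1)` for `j = 0, …, m₀ − 1`. -/
noncomputable def diskFamily (m₀ : ℕ) (h₀ : ℝ) (i : Fin (m₀ + 1)) : Set ℂ :=
  if i = 0 then Metric.closedBall 0 1
  else Metric.closedBall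
    ((h₀ : ℂ) * Complex.exp (2 * Real.pi * Complex.I * (((i : ℕ) - 1 : ℕ) : ℂ) / (m₀ : ℂ))) 1


/-- Hermite interpolation: the polynomial attached to one circle. -/
lemma hermite_poly (P : Polynomial ℂ) (n : ℕ) (hP : P.natDegree ≤ n + 1) (c : ℂ) (R : ℝ)
    (hR : 0 ≤ R) (hne : ∀ ζ ∈ sphere c R, P.eval ζ ≠ 0) :
    ∃ p : Polynomial ℂ, p.degree ≤ (n : ℕ) ∧ ∀ z, z ∉ sphere c R →
      p.eval z = (∮ ζ in C(c, R), (ζ - z)⁻¹)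
        - ∮ ζ in C(c, R), (ζ - z)⁻¹ * (P.eval z / P.eval ζ) := by
  refine ⟨∑ a ∈ Finset.range (n + 2), ∑ b ∈ Finset.range a,
    Polynomial.C (P.coeff a * ∮ ζ in C(c, R), (P.eval ζ)⁻¹ * ζ ^ (a - 1 - b)) * Polynomial.X ^ b,
    ?_, ?_⟩
  · refine (Polynomial.degree_sum_le _ _).trans (Finset.sup_le fun a ha => ?_)
    refine (Polynomial.degree_sum_le _ _).trans (Finset.sup_le fun b hb => ?_)
    refine (Polynomial.degree_C_mul_X_pow_le _ _).trans ?_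
    simp only [Finset.mem_range] at ha hb
    exact_mod_cast (by omega : b ≤ n)
  · intro z hz
    have hsub : ∀ ζ ∈ sphere c R, ζ - z ≠ 0 := by
      intro ζ hζ h
      rw [sub_eq_zero] at h
      exact hz (h ▸ hζ)
    have hPc : ContinuousOn (fun ζ => P.eval ζ) (sphere c R) := P.continuous.continuousOn
    have hinv : ContinuousOn (fun ζ => (P.eval ζ)⁻¹) (sphere c R) := hPc.inv₀ hne
    have hsinv : ContinuousOn (fun ζ : ℂ => (ζ - z)⁻¹) (sphere c R) :=
      (by fun_prop : ContinuousOn (fun ζ : ℂ => ζ - z) (sphere c R)).inv₀ hsub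
    have hterm : ∀ k : ℕ, ContinuousOn (fun ζ : ℂ => (P.eval ζ)⁻¹ * ζ ^ k) (sphere c R) :=
      fun k => hinv.mul (by fun_prop)
    have hq : ContinuousOn (fun ζ : ℂ => (ζ - z)⁻¹ * (P.eval z / P.eval ζ)) (sphere c R) :=
      hsinv.mul (continuousOn_const.div hPc hne)
    rw [← circleIntegral.integral_sub (hsinv.circleIntegrable hR) (hq.circleIntegrable hR)]
    have key : Set.EqOn (fun ζ : ℂ => (ζ - z)⁻¹ - (ζ - z)⁻¹ * (P.eval z / P.eval ζ))
        (fun ζ => ∑ a ∈ Finset.range (n + 2), ∑ b ∈ Finset.range a,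
          (P.coeff a * z ^ b) * ((P.eval ζ)⁻¹ * ζ ^ (a - 1 - b))) (sphere c R) := by
      intro ζ hζ
      have h1 := hsub ζ hζ
      have h2 := hne ζ hζ
      have h3 : P.eval ζ - P.eval z
          = (ζ - z) * ∑ a ∈ Finset.range (n + 2), ∑ b ∈ Finset.range a,
            (P.coeff a * z ^ b) * ζ ^ (a - 1 - b) := by
        rw [Polynomial.eval_eq_sum_range' (Nat.lt_succ_of_le hP) ζ,
          Polynomial.eval_eq_sum_range' (Nat.lt_succ_of_le hP) z, ← Finset.sum_sub_distrib,
          Finset.mul_sum]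
        refine Finset.sum_congr rfl fun a _ => ?_
        have := geom_sum₂_mul z ζ a
        rw [← mul_sub, ← neg_sub (z ^ a), ← this]
        simp only [mul_assoc, ← Finset.mul_sum]
        ring
      have h4 : ∑ a ∈ Finset.range (n + 2), ∑ b ∈ Finset.range a,
          (P.coeff a * z ^ b) * ((P.eval ζ)⁻¹ * ζ ^ (a - 1 - b))
          = (P.eval ζ)⁻¹ * ∑ a ∈ Finset.range (n + 2), ∑ b ∈ Finset.range a,
            (P.coeff a * z ^ b) * ζ ^ (a - 1 - b) := by
        simp only [Finset.mul_sum]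
        refine Finset.sum_congr rfl fun a _ => Finset.sum_congr rfl fun b _ => by ring
      show (ζ - z)⁻¹ - (ζ - z)⁻¹ * (P.eval z / P.eval ζ) = _
      dsimp only
      rw [h4]
      have h5 : ∑ a ∈ Finset.range (n + 2), ∑ b ∈ Finset.range a,
            (P.coeff a * z ^ b) * ζ ^ (a - 1 - b) = (ζ - z)⁻¹ * (P.eval ζ - P.eval z) := by
        rw [h3, inv_mul_cancel_left₀ h1]
      rw [h5]
      field_simp
    rw [circleIntegral.integral_congr hR key, circleIntegral.integral_fun_sum]
    · rw [Polynomial.eval_finsetSum]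
      refine Finset.sum_congr rfl fun a _ => ?_
      rw [circleIntegral.integral_fun_sum, Polynomial.eval_finsetSum]
      · refine Finset.sum_congr rfl fun b _ => ?_
        rw [circleIntegral.integral_const_mul]
        simp only [Polynomial.eval_mul, Polynomial.eval_C, Polynomial.eval_pow, Polynomial.eval_X]
        ring
      · intro b _
        exact (continuousOn_const.mul (hterm _)).circleIntegrable hR
    · intro a _
      refine CircleIntegrable.fun_sum _ fun b _ => ?_
      exact (continuousOn_const.mul (hterm _)).circleIntegrable hR

lemma integral_outside (c z : ℂ) (R : ℝ) (hR : 0 ≤ R) (hz : R < dist z c) :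
    (∮ ζ in C(c, R), (ζ - z)⁻¹) = 0 := by
  have hsub : ∀ ζ ∈ closedBall c R, ζ - z ≠ 0 := by
    intro ζ hζ h
    rw [sub_eq_zero] at h
    rw [h, mem_closedBall] at hζ
    linarith
  refine Complex.circleIntegral_eq_zero_of_differentiable_on_off_countable hR
    Set.countable_empty ?_ ?_
  · exact (by fun_prop : ContinuousOn (fun ζ : ℂ => ζ - z) _).inv₀ hsub
  · intro ζ hζ
    exact (by fun_prop : DifferentiableAt ℂ (fun ζ : ℂ => ζ - z) ζ).inv
      (hsub ζ (ball_subset_closedBall hζ.1))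

lemma approx_exists {ι : Type*} [Fintype ι] [DecidableEq ι] (c : ι → ℂ) (v : ι → ℂ) (r : ℝ)
    (hr : 1 < r)
    (hsep : ∀ i j, i ≠ j → 2 * r ≤ dist (c i) (c j)) (P : Polynomial ℂ) (n : ℕ)
    (hP : P.natDegree ≤ n + 1) (A B : ℝ) (hA : 0 < A)
    (hlow : ∀ i, ∀ ζ ∈ sphere (c i) r, A ≤ ‖P.eval ζ‖)
    (hup : ∀ i, ∀ z ∈ closedBall (c i) 1, ‖P.eval z‖ ≤ B) :
    ∃ p : Polynomial ℂ, p.degree ≤ (n : ℕ) ∧ ∀ j, ∀ z ∈ closedBall (c j) 1,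
      ‖v j - p.eval z‖ ≤ (∑ i, ‖v i‖ * (r * (r - 1)⁻¹)) * (B / A) := by
  have hr0 : (0 : ℝ) ≤ r := by linarith
  choose p hp1 hp2 using fun i => hermite_poly P n hP (c i) r hr0 (fun ζ hζ h => by
    have := hlow i ζ hζ
    rw [h, norm_zero] at this
    linarith)
  refine ⟨∑ i, Polynomial.C (v i * (2 * Real.pi * Complex.I)⁻¹) * p i, ?_, ?_⟩
  · refine (Polynomial.degree_sum_le _ _).trans (Finset.sup_le fun i _ => ?_)
    rw [Polynomial.C_mul']
    exact (Polynomial.degree_smul_le _ _).trans (hp1 i)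
  · intro j z hz
    have hdist : ∀ i, ∀ ζ ∈ sphere (c i) r, r - 1 ≤ ‖ζ - z‖ := by
      intro i ζ hζ
      rw [mem_closedBall] at hz
      rw [mem_sphere] at hζ
      rw [← dist_eq_norm]
      by_cases hij : i = j
      · subst hij
        have := dist_triangle ζ z (c i)
        linarith
      · have h1 := hsep i j hij
        have h2 := dist_triangle (c i) ζ (c j)
        have h3 := dist_triangle ζ z (c j)
        rw [dist_comm (c i) ζ] at h2
        linarith
    have hns : ∀ i, z ∉ sphere (c i) r := by
      intro i h
      have := hdist i z h
      simp at this
      linarith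
    have hcau : ∀ i, (2 * Real.pi * Complex.I : ℂ)⁻¹ * (∮ ζ in C(c i, r), (ζ - z)⁻¹)
        = if i = j then 1 else 0 := by
      intro i
      split_ifs with hij
      · subst hij
        rw [circleIntegral.integral_sub_inv_of_mem_ball
          (mem_ball.2 (lt_of_le_of_lt (mem_closedBall.1 hz) hr)),
          inv_mul_cancel₀ Complex.two_pi_I_ne_zero]
      · rw [integral_outside, mul_zero]
        · exact hr0
        · have h1 := hsep i j hij
          have h2 := dist_triangle (c i) z (c j)
          rw [mem_closedBall] at hz
          rw [dist_comm (c i) z] at h2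
          linarith
    have hv : v j - Polynomial.eval z (∑ i, Polynomial.C (v i * (2 * Real.pi * Complex.I)⁻¹) * p i)
        = ∑ i, v i * ((2 * Real.pi * Complex.I : ℂ)⁻¹ •
          ∮ ζ in C(c i, r), (ζ - z)⁻¹ * (P.eval z / P.eval ζ)) := by
      have : v j = ∑ i, v i * ((2 * Real.pi * Complex.I : ℂ)⁻¹ *
          (∮ ζ in C(c i, r), (ζ - z)⁻¹)) := by
        simp only [hcau]
        simp
      rw [this, Polynomial.eval_finsetSum, ← Finset.sum_sub_distrib]
      refine Finset.sum_congr rfl fun i _ => ?_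
      rw [Polynomial.eval_mul, Polynomial.eval_C, hp2 i z (hns i), smul_eq_mul]
      ring
    rw [hv, Finset.sum_mul]
    refine (norm_sum_le _ _).trans (Finset.sum_le_sum fun i _ => ?_)
    rw [norm_mul, mul_assoc ‖v i‖]
    refine mul_le_mul_of_nonneg_left ?_ (norm_nonneg (v i))
    rw [mul_assoc r]
    refine circleIntegral.norm_two_pi_i_inv_smul_integral_le_of_norm_le_const hr0 ?_
    intro ζ hζ
    rw [norm_mul, norm_inv, norm_div]
    have hB := hup j z hz
    have hA' := hlow i ζ hζ
    have hB0 : 0 ≤ B := (norm_nonneg _).trans hB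
    have hd := hdist i ζ hζ
    have : 0 < r - 1 := by linarith
    gcongr

lemma dApprox_le (L : Set ℂ) (G : ℂ → ℂ) (n : ℕ) (c : ℝ) (hc : 0 ≤ c) (p : Polynomial ℂ)
    (hp : p.degree ≤ (n : ℕ)) (h : ∀ z ∈ L, ‖G z - p.eval z‖ ≤ c) : dApprox L G n ≤ c := by
  unfold dApprox
  refine csInf_le_of_le (b := supNorm (fun z => G z - Polynomial.eval z p) L) ⟨0, ?_⟩
    ⟨p, hp, rfl⟩ ?_
  · rintro _ ⟨p, _, rfl⟩
    refine Real.sSup_nonneg ?_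
    rintro _ ⟨z, _, rfl⟩
    exact norm_nonneg _
  · refine Real.sSup_le ?_ hc
    rintro _ ⟨z, hz, rfl⟩
    exact h z hz

lemma dApprox_nonneg (L : Set ℂ) (G : ℂ → ℂ) (n : ℕ) : 0 ≤ dApprox L G n := by
  refine Real.sInf_nonneg ?_
  rintro _ ⟨p, _, rfl⟩
  refine Real.sSup_nonneg ?_
  rintro _ ⟨z, _, rfl⟩
  exact norm_nonneg _

lemma rho_le (L : Set ℂ) (G : ℂ → ℂ) (D : ℕ) (hD : 1 ≤ D) (C Q : ℝ) (hC : 0 < C) (hQ : 0 < Q)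
    (h : ∀ n k : ℕ, k * D ≤ n + 1 → dApprox L G n ≤ C * Q ^ k) :
    rho L G ≤ Q ^ (1 / (D : ℝ)) := by
  set t : ℝ := Q ^ (1 / (D : ℝ)) with ht
  have ht0 : 0 < t := Real.rpow_pos_of_pos hQ _
  have hD0 : (D : ℝ) ≠ 0 := by positivity
  have htD : t ^ D = Q := by
    rw [ht, ← Real.rpow_natCast, ← Real.rpow_mul hQ.le, one_div, inv_mul_cancel₀ hD0,
      Real.rpow_one]
  set M : ℝ := max t 1 * max t⁻¹ 1 ^ D with hM
  have hM0 : 0 < M := by positivity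
  have hb : ∀ n : ℕ, dApprox L G n ≤ (C * M) * t ^ n := by
    intro n
    have hdm := Nat.div_add_mod (n + 1) D
    have hml := Nat.mod_lt (n + 1) (by omega : 0 < D)
    set k := (n + 1) / D
    set e := (n + 1) % D
    refine (h n k (by rw [mul_comm]; omega)).trans ?_
    rw [mul_assoc]
    refine mul_le_mul_of_nonneg_left ?_ hC.le
    have h1 : Q ^ k = t ^ n * (t * t⁻¹ ^ e) := by
      have h2 : t ^ (D * k) * t ^ e = t ^ n * t := by
        rw [← pow_add, ← pow_succ, hdm]
      rw [← htD, ← pow_mul]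
      rw [← mul_assoc, ← h2, mul_assoc, ← mul_pow, mul_inv_cancel₀ ht0.ne', one_pow, mul_one]
    rw [h1, mul_comm]
    refine mul_le_mul_of_nonneg_right ?_ (by positivity)
    have h3 : t⁻¹ ^ e ≤ max t⁻¹ 1 ^ D :=
      (pow_le_pow_left₀ (by positivity) (le_max_left _ _) e).trans
        (pow_le_pow_right₀ (le_max_right _ _) hml.le)
    exact mul_le_mul (le_max_left _ _) h3 (by positivity) (by positivity)
  have hlim : Tendsto (fun n : ℕ => (C * M) ^ (1 / (n : ℝ)) * t) atTop (𝓝 t) := by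
    have h1 : Tendsto (fun n : ℕ => (1 / (n : ℝ))) atTop (𝓝 0) := tendsto_one_div_atTop_nhds_zero_nat
    have h2 := (Real.continuous_const_rpow (a := C * M) (by positivity)).tendsto 0
    have h3 := (h2.comp h1).mul_const t
    simpa using h3
  have hev : (fun n : ℕ => dApprox L G n ^ (1 / (n : ℝ)))
      ≤ᶠ[atTop] fun n : ℕ => (C * M) ^ (1 / (n : ℝ)) * t := by
    filter_upwards [eventually_ge_atTop 1] with n hn
    have hn0 : (n : ℝ) ≠ 0 := by positivity
    refine (Real.rpow_le_rpow (dApprox_nonneg _ _ _) (hb n) (by positivity)).trans ?_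
    rw [Real.mul_rpow (by positivity) (by positivity), ← Real.rpow_natCast t n,
      ← Real.rpow_mul ht0.le, mul_one_div_cancel hn0, Real.rpow_one]
  calc rho L G ≤ limsup (fun n : ℕ => (C * M) ^ (1 / (n : ℝ)) * t) atTop :=
        limsup_le_limsup hev
          (isCoboundedUnder_le_of_le atTop (x := 0) fun n =>
            Real.rpow_nonneg (dApprox_nonneg _ _ _) _)
          hlim.isBoundedUnder_le
    _ = t := hlim.limsup_eq

/-- The centres of the discs. -/
noncomputable def ctr (m : ℕ) (h : ℝ) (i : Fin (m + 1)) : ℂ :=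
  if i = 0 then 0
  else (h : ℂ) * Complex.exp (2 * Real.pi * Complex.I * (((i : ℕ) - 1 : ℕ) : ℂ) / (m : ℂ))

lemma diskFamily_eq (m : ℕ) (h : ℝ) (i : Fin (m + 1)) :
    diskFamily m h i = closedBall (ctr m h i) 1 := by
  unfold diskFamily ctr
  split_ifs <;> rfl

lemma ctr_zero (m : ℕ) (h : ℝ) : ctr m h 0 = 0 := by simp [ctr]

lemma ctr_succ (m : ℕ) (h : ℝ) (i : Fin m) :
    ctr m h i.succ = (h : ℂ) * Complex.exp (Complex.I * ((2 * Real.pi * (i : ℕ) / m : ℝ) : ℂ)) := by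
  simp only [ctr, Fin.succ_ne_zero, if_false, Fin.val_succ, Nat.add_sub_cancel]
  congr 2
  push_cast
  ring

lemma norm_ctr_succ (m : ℕ) (h : ℝ) (h0 : 0 ≤ h) (i : Fin m) : ‖ctr m h i.succ‖ = h := by
  rw [ctr_succ, norm_mul, mul_comm Complex.I, Complex.norm_exp_ofReal_mul_I]
  simp [abs_of_nonneg h0]

lemma dist_ctr_lt (m : ℕ) (h : ℝ) (h0 : 0 ≤ h) (i j : Fin m) (hij : j < i) :
    2 * h * Real.sin (Real.pi / m) ≤ dist (ctr m h i.succ) (ctr m h j.succ) := by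
  have him := i.2
  have hij' : (j : ℕ) < (i : ℕ) := hij
  have hm0 : (0 : ℝ) < m := by
    have : 0 < m := by omega
    exact_mod_cast this
  obtain ⟨d, hd⟩ := Nat.exists_eq_add_of_lt hij'
  set x : ℝ := Real.pi * ((d : ℝ) + 1) / m with hx
  have hfac : ctr m h i.succ - ctr m h j.succ
      = ctr m h j.succ * (Complex.exp (Complex.I * ((2 * x : ℝ) : ℂ)) - 1) := by
    rw [ctr_succ, ctr_succ, mul_sub, mul_one, mul_assoc (h : ℂ), ← Complex.exp_add, ← mul_add,
      ← Complex.ofReal_add]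
    congr 5
    rw [hd, hx]
    push_cast
    ring
  rw [dist_eq_norm, hfac, norm_mul, norm_ctr_succ m h h0, Complex.norm_exp_I_mul_ofReal_sub_one]
  rw [mul_comm 2 h, mul_assoc]
  refine mul_le_mul_of_nonneg_left ?_ h0
  rw [mul_div_cancel_left₀ x two_ne_zero]
  refine le_trans ?_ (le_abs_self _)
  refine mul_le_mul_of_nonneg_left ?_ zero_le_two
  have hpi := Real.pi_pos
  have h1 : Real.pi / m ≤ x := by
    rw [hx]
    gcongr
    nlinarith [(Nat.cast_nonneg d : (0 : ℝ) ≤ d)]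
  have h2 : x ≤ Real.pi - Real.pi / m := by
    have : ((d : ℝ) + 1) + 1 ≤ m := by exact_mod_cast (by omega : d + 1 + 1 ≤ m)
    rw [hx, le_sub_iff_add_le, ← add_div, div_le_iff₀ hm0]
    nlinarith
  have h3 : 0 < Real.pi / m := by positivity
  rcases le_total x (Real.pi / 2) with hc | hc
  · exact Real.sin_le_sin_of_le_of_le_pi_div_two (by linarith) hc h1
  · rw [← Real.sin_pi_sub x]
    exact Real.sin_le_sin_of_le_of_le_pi_div_two (by linarith) (by linarith) (by linarith)

lemma dist_ctr (m : ℕ) (h : ℝ) (h0 : 0 ≤ h) (i j : Fin m) (hij : i ≠ j) :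
    2 * h * Real.sin (Real.pi / m) ≤ dist (ctr m h i.succ) (ctr m h j.succ) := by
  rcases lt_or_gt_of_ne hij with hlt | hlt
  · rw [dist_comm]
    exact dist_ctr_lt m h h0 j i hlt
  · exact dist_ctr_lt m h h0 i j hlt

lemma norm_le_prod {m : ℕ} (f : Fin m → ℝ) (i : Fin m) (a b : ℝ) (ha : 0 ≤ a) (hb : 0 ≤ b)
    (h1 : a ≤ f i) (h2 : ∀ j, j ≠ i → b ≤ f j) : a * b ^ (m - 1) ≤ ∏ j, f j := by
  rw [← Finset.mul_prod_erase Finset.univ f (Finset.mem_univ i)]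
  have hc : (Finset.univ.erase i).card = m - 1 := by simp
  refine mul_le_mul h1 ?_ (by positivity) (ha.trans h1)
  rw [← hc, ← Finset.prod_const]
  exact Finset.prod_le_prod (fun _ _ => hb) fun j hj => h2 j (Finset.ne_of_mem_erase hj)

lemma prod_le_norm {m : ℕ} (f : Fin m → ℝ) (i : Fin m) (a b : ℝ) (hf : ∀ j, 0 ≤ f j)
    (h1 : f i ≤ a) (h2 : ∀ j, j ≠ i → f j ≤ b) : ∏ j, f j ≤ a * b ^ (m - 1) := by
  rw [← Finset.mul_prod_erase Finset.univ f (Finset.mem_univ i)]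
  have hc : (Finset.univ.erase i).card = m - 1 := by simp
  refine mul_le_mul h1 ?_ (Finset.prod_nonneg fun j _ => hf j) ((hf i).trans h1)
  rw [← hc, ← Finset.prod_const]
  exact Finset.prod_le_prod (fun j _ => hf j) fun j hj => h2 j (Finset.ne_of_mem_erase hj)

/-- Example 3.2 (quantitative bound): for `m₀ ≥ 7` and `h₀ > 2/sin(π/m₀)`, with
`ℓ₀ = (1/2)sin(π/m₀)(1 − (1/2)sin(π/m₀))((3/2)sin(π/m₀))^{m₀−1}`, one has
`ρ_L ≤ ((1+h₀)(1+2h₀)^{m₀−1} / (ℓ₀ h₀^{m₀+1}))^{1/(m₀+1)}`. -/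
theorem stmt13 (m₀ : ℕ) (hm : 7 ≤ m₀) (h₀ : ℝ)
    (hh : 2 / Real.sin (Real.pi / (m₀ : ℝ)) < h₀)
    (F : ℂ → ℂ)
    (hF : ∀ i : Fin (m₀ + 1), ∀ z ∈ diskFamily m₀ h₀ i, F z = ((i : ℕ) : ℂ)) :
    rho (⋃ i, diskFamily m₀ h₀ i) F ≤
      (((1 + h₀) * (1 + 2 * h₀) ^ (m₀ - 1)) /
        ((1 / 2 * Real.sin (Real.pi / (m₀ : ℝ)) *
          (1 - 1 / 2 * Real.sin (Real.pi / (m₀ : ℝ))) *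
          (3 / 2 * Real.sin (Real.pi / (m₀ : ℝ))) ^ (m₀ - 1)) * h₀ ^ (m₀ + 1)))
        ^ (1 / ((m₀ : ℝ) + 1)) := by
  have hm7 : (7 : ℝ) ≤ m₀ := by exact_mod_cast hm
  have hpi := Real.pi_pos
  have hdist := dist_ctr m₀ h₀
  have hs0 : 0 < Real.sin (Real.pi / m₀) := by
    refine Real.sin_pos_of_pos_of_lt_pi (by positivity) ?_
    rw [div_lt_iff₀ (by linarith)]
    nlinarith
  have hs1 : Real.sin (Real.pi / m₀) ≤ 1 / 2 := by
    rw [← Real.sin_pi_div_six]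
    refine Real.sin_le_sin_of_le_of_le_pi_div_two ?_ (by linarith) ?_
    · have : 0 < Real.pi / m₀ := by positivity
      linarith
    · gcongr
      linarith
  set s := Real.sin (Real.pi / m₀)
  have hsh : 2 < h₀ * s := by rwa [div_lt_iff₀ hs0] at hh
  have hh0 : 0 < h₀ := lt_trans (by positivity) hh
  replace hdist := hdist hh0.le
  have hnorm := norm_ctr_succ m₀ h₀ hh0.le
  set r : ℝ := h₀ * s / 2 with hr
  have hr1 : 1 < r := by rw [hr]; linarith
  have hrh : r ≤ h₀ / 4 := by rw [hr]; nlinarith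
  have hsep : ∀ i j, i ≠ j → 2 * r ≤ dist (ctr m₀ h₀ i) (ctr m₀ h₀ j) := by
    intro i j
    induction i using Fin.cases with
    | zero =>
      induction j using Fin.cases with
      | zero => intro h; exact absurd rfl h
      | succ j =>
        intro _
        rw [ctr_zero, dist_comm, dist_zero_right, hnorm]
        linarith
    | succ i =>
      induction j using Fin.cases with
      | zero =>
        intro _
        rw [ctr_zero, dist_zero_right, hnorm]
        linarith
      | succ j =>
        intro h
        have := hdist i j (fun e => h (by rw [e]))
        nlinarith
  set q : Polynomial ℂ := ∏ i, (Polynomial.X - Polynomial.C (ctr m₀ h₀ i)) with hq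
  have hqdeg : q.natDegree = m₀ + 1 := by
    rw [hq, Polynomial.natDegree_finsetProd_X_sub_C_eq_card]
    simp
  have hqeval : ∀ z, ‖q.eval z‖ = ‖z‖ * ∏ i : Fin m₀, ‖z - ctr m₀ h₀ i.succ‖ := by
    intro z
    rw [hq, Polynomial.eval_prod, norm_prod, Fin.prod_univ_succ]
    simp [ctr_zero]
  set A : ℝ := (1 / 2 * s * (1 - 1 / 2 * s) * (3 / 2 * s) ^ (m₀ - 1)) * h₀ ^ (m₀ + 1) with hAdef
  set B : ℝ := (1 + h₀) * (1 + 2 * h₀) ^ (m₀ - 1) with hBdef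
  have hs2 : 0 < 1 - 1 / 2 * s := by linarith
  have hA : 0 < A := by positivity
  have hB : 0 < B := by positivity
  have hA' : A = r * ((h₀ - r) * (3 * r) ^ (m₀ - 1)) := by
    obtain ⟨k, rfl⟩ : ∃ k, m₀ = k + 1 := ⟨m₀ - 1, by omega⟩
    have e1 : h₀ - r = h₀ * (1 - 1 / 2 * s) := by rw [hr]; ring
    have e2 : 3 * r = h₀ * (3 / 2 * s) := by rw [hr]; ring
    rw [e1, e2, hAdef, hr, Nat.add_sub_cancel, mul_pow h₀]
    ring
  have hlow : ∀ i, ∀ ζ ∈ sphere (ctr m₀ h₀ i) r, A ≤ ‖q.eval ζ‖ := by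
    intro i ζ hζ
    rw [hqeval, hA']
    rw [mem_sphere] at hζ
    have i0 : Fin m₀ := ⟨0, by omega⟩
    induction i using Fin.cases with
    | zero =>
      rw [ctr_zero, dist_zero_right] at hζ
      rw [hζ]
      refine mul_le_mul_of_nonneg_left ?_ (by linarith)
      have hj : ∀ j : Fin m₀, h₀ - r ≤ ‖ζ - ctr m₀ h₀ j.succ‖ := by
        intro j
        have := norm_sub_norm_le (ctr m₀ h₀ j.succ) ζ
        rw [hnorm, hζ, norm_sub_rev] at this
        exact this
      refine norm_le_prod _ i0 _ _ (by linarith) (by linarith) (hj i0) fun j _ => ?_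
      exact le_trans (by linarith) (hj j)
    | succ i =>
      have h1 : h₀ - r ≤ ‖ζ‖ := by
        have := norm_sub_norm_le (ctr m₀ h₀ i.succ) ζ
        rw [hnorm, norm_sub_rev, ← dist_eq_norm, hζ] at this
        linarith
      have h2 : r * (3 * r) ^ (m₀ - 1) ≤ ∏ j : Fin m₀, ‖ζ - ctr m₀ h₀ j.succ‖ := by
        refine norm_le_prod _ i _ _ (by linarith) (by linarith) ?_ fun j hj => ?_
        · rw [← dist_eq_norm, hζ]
        · have h3 := hdist i j hj.symm
          have h4 := dist_triangle (ctr m₀ h₀ i.succ) ζ (ctr m₀ h₀ j.succ)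
          rw [dist_comm _ ζ, hζ] at h4
          rw [← dist_eq_norm]
          have : 2 * h₀ * s = 4 * r := by rw [hr]; ring
          linarith
      calc r * ((h₀ - r) * (3 * r) ^ (m₀ - 1)) = (h₀ - r) * (r * (3 * r) ^ (m₀ - 1)) := by ring
        _ ≤ _ := mul_le_mul h1 h2 (by positivity) (norm_nonneg _)
  have hup : ∀ i, ∀ z ∈ closedBall (ctr m₀ h₀ i) 1, ‖q.eval z‖ ≤ B := by
    intro i z hz
    rw [hqeval]
    rw [mem_closedBall] at hz
    have i0 : Fin m₀ := ⟨0, by omega⟩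
    induction i using Fin.cases with
    | zero =>
      rw [ctr_zero, dist_zero_right] at hz
      have hj : ∀ j : Fin m₀, ‖z - ctr m₀ h₀ j.succ‖ ≤ 1 + h₀ := by
        intro j
        have := norm_sub_le z (ctr m₀ h₀ j.succ)
        rw [hnorm] at this
        linarith
      have h2 := prod_le_norm (fun j : Fin m₀ => ‖z - ctr m₀ h₀ j.succ‖) i0 (1 + h₀) (1 + 2 * h₀)
        (fun _ => norm_nonneg _) (hj i0) (fun j _ => (hj j).trans (by linarith))
      calc _ ≤ 1 * B := mul_le_mul hz h2 (Finset.prod_nonneg fun _ _ => norm_nonneg _) zero_le_one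
        _ = B := one_mul _
    | succ i =>
      have h1 : ‖z‖ ≤ 1 + h₀ := by
        have := norm_sub_norm_le z (ctr m₀ h₀ i.succ)
        rw [hnorm, ← dist_eq_norm] at this
        linarith
      have h2 := prod_le_norm (fun j : Fin m₀ => ‖z - ctr m₀ h₀ j.succ‖) i 1 (1 + 2 * h₀)
        (fun _ => norm_nonneg _) (by rwa [← dist_eq_norm]) (fun j _ => by
          have := norm_sub_le z (ctr m₀ h₀ j.succ)
          rw [hnorm] at this
          linarith)
      rw [one_mul] at h2
      exact mul_le_mul h1 h2 (Finset.prod_nonneg fun _ _ => norm_nonneg _) (by linarith)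
  set S : ℝ := ∑ i : Fin (m₀ + 1), ‖(((i : ℕ) : ℂ))‖ * (r * (r - 1)⁻¹) with hS
  have hr2 : 0 < r - 1 := by linarith
  have hS0 : 0 ≤ S := Finset.sum_nonneg fun i _ => by positivity
  have hfin := rho_le (⋃ i, diskFamily m₀ h₀ i) F (m₀ + 1) (by omega) (S + 1) (B / A)
    (by linarith) (by positivity) (by
      intro n k hk
      obtain ⟨p, hp1, hp2⟩ := approx_exists (ctr m₀ h₀) (fun i => ((i : ℕ) : ℂ)) r hr1 hsep
        (q ^ k) n ((Polynomial.natDegree_pow_le).trans (by rw [hqdeg]; exact hk)) (A ^ k) (B ^ k)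
        (by positivity)
        (fun i ζ hζ => by
          rw [Polynomial.eval_pow, norm_pow]
          exact pow_le_pow_left₀ hA.le (hlow i ζ hζ) k)
        (fun i z hz => by
          rw [Polynomial.eval_pow, norm_pow]
          exact pow_le_pow_left₀ (norm_nonneg _) (hup i z hz) k)
      refine dApprox_le _ _ _ _ (by positivity) p hp1 ?_
      intro z hz
      obtain ⟨i, hi⟩ := Set.mem_iUnion.1 hz
      rw [hF i z hi]
      rw [diskFamily_eq] at hi
      refine (hp2 i z hi).trans ?_
      rw [← div_pow]
      refine mul_le_mul_of_nonneg_right ?_ (by positivity)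
      linarith)
  push_cast at hfin
  exact hfin
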